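/- arXiv:2205.05148 — 5 statements merged into one kernel-verified Lean document; each statement's English description precedes it below -/
import Mathlib

section
/- Let Q be a quasivariety and K ⊆ Q a class satisfying: (i) K is closed under isomorphisms and substructures; (ii) every relatively subdirectly irreducible member of Q belongs to K; (iii) for every B ∈ Q, every substructure A of B, and every surjective homomorphism f : A → C with C ∈ K, there exist D ∈ K and a surjective homomorphism g : B → D with ker g ∩ (A×A) = ker f; (iv) every doubly injective span in K has an amalgam in Q. Then Q has the amalgamation property. -/
open FirstOrder Language Set

universe u

namespace Transfer

variable (L : FirstOrder.Language.{u, u})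

/-- A bundled `L`-structure with carrier in universe `u`. -/
structure Struc : Type (u + 1) where
  Carrier : Type u
  [str : L.Structure Carrier]

attribute [instance] Struc.str

/-- Product structure on a Pi type. -/
instance piStructure {ι : Type u} (M : ι → Type u) [∀ i, L.Structure (M i)] :
    L.Structure (∀ i, M i) where
  funMap f x i := Structure.funMap f fun j => x j i
  RelMap r x := ∀ i, Structure.RelMap r fun j => x j i

/-- Product structure on a binary product. -/
instance prodStructure (M N : Type u) [L.Structure M] [L.Structure N] :
    L.Structure (M × N) where
  funMap f x := (Structure.funMap f fun j => (x j).1, Structure.funMap f fun j => (x j).2)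
  RelMap r x := Structure.RelMap r (fun j => (x j).1) ∧ Structure.RelMap r (fun j => (x j).2)

variable {L}

/-- The bundled structure on a substructure. -/
abbrev ofSub (B : Struc L) (S : L.Substructure B.Carrier) : Struc L := ⟨S⟩

/-- The kernel of a map, as a set of pairs. -/
def kerSet {α β : Type u} (f : α → β) : Set (α × α) := {p | f p.1 = f p.2}

/-- The restriction of a binary relation on `B` to a substructure `S`. -/
def restrict {B : Struc L} (S : L.Substructure B.Carrier)
    (Θ : Set (B.Carrier × B.Carrier)) : Set ((ofSub B S).Carrier × (ofSub B S).Carrier) :=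
  {p | ((p.1 : B.Carrier), (p.2 : B.Carrier)) ∈ Θ}

/-- The image of a binary relation on a substructure `S` in `B`. -/
def lift {B : Struc L} (S : L.Substructure B.Carrier)
    (Θ : Set ((ofSub B S).Carrier × (ofSub B S).Carrier)) : Set (B.Carrier × B.Carrier) :=
  (fun p => ((p.1 : B.Carrier), (p.2 : B.Carrier))) '' Θ

/-- The set of `Q`-congruences of `A`: kernels of homomorphisms into members of `Q`. -/
def ConQ (Q : Set (Struc L)) (A : Struc L) : Set (Set (A.Carrier × A.Carrier)) :=
  {θ | ∃ M ∈ Q, ∃ f : A.Carrier →[L] M.Carrier, θ = kerSet f}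

/-- The least `Q`-congruence of `A` containing `R`. -/
def cgQ (Q : Set (Struc L)) (A : Struc L) (R : Set (A.Carrier × A.Carrier)) :
    Set (A.Carrier × A.Carrier) :=
  ⋂₀ {θ | θ ∈ ConQ Q A ∧ R ⊆ θ}

/-- The join of two `Q`-congruences in `Con_Q A`. -/
def joinQ (Q : Set (Struc L)) (A : Struc L) (θ φ : Set (A.Carrier × A.Carrier)) :
    Set (A.Carrier × A.Carrier) :=
  cgQ Q A (θ ∪ φ)

/-- `θ` is a meet-irreducible element of `Con_Q A`. -/
def MeetIrred (Q : Set (Struc L)) (A : Struc L) (θ : Set (A.Carrier × A.Carrier)) : Prop :=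
  θ ∈ ConQ Q A ∧
    ∀ θ₁ ∈ ConQ Q A, ∀ θ₂ ∈ ConQ Q A, θ = θ₁ ∩ θ₂ → θ = θ₁ ∨ θ = θ₂

/-- `θ` is a completely meet-irreducible element of `Con_Q A`. -/
def CompletelyMeetIrred (Q : Set (Struc L)) (A : Struc L)
    (θ : Set (A.Carrier × A.Carrier)) : Prop :=
  θ ∈ ConQ Q A ∧
    ∀ S ⊆ ConQ Q A, θ = ⋂₀ S → θ ∈ S

/-- The class of relatively finitely subdirectly irreducible members of `Q`. -/
def RFSI (Q : Set (Struc L)) : Set (Struc L) :=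
  {A | A ∈ Q ∧ MeetIrred Q A (Set.diagonal A.Carrier)}

/-- The class of relatively subdirectly irreducible members of `Q`. -/
def RSI (Q : Set (Struc L)) : Set (Struc L) :=
  {A | A ∈ Q ∧ CompletelyMeetIrred Q A (Set.diagonal A.Carrier)}

/-- `B` has the `Q`-congruence extension property. -/
def HasQCEP (Q : Set (Struc L)) (B : Struc L) : Prop :=
  ∀ S : L.Substructure B.Carrier, ∀ θ ∈ ConQ Q (ofSub B S),
    ∃ Φ ∈ ConQ Q B, restrict S Φ = θ

/-- A class `K` of members of `Q` has the `Q`-congruence extension property. -/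
def ClassQCEP (Q K : Set (Struc L)) : Prop :=
  ∀ B ∈ K, HasQCEP Q B

variable (L)

/-- `Q` is a quasivariety: closed under isomorphisms, substructures, direct products,
and ultraproducts. -/
def IsQuasivariety (Q : Set (Struc L)) : Prop :=
  (∀ A ∈ Q, ∀ B : Struc L, Nonempty (A.Carrier ≃[L] B.Carrier) → B ∈ Q) ∧
  (∀ B ∈ Q, ∀ S : L.Substructure B.Carrier, ofSub B S ∈ Q) ∧
  (∀ (ι : Type u) (f : ι → Struc L), (∀ i, f i ∈ Q) →
    (⟨∀ i, (f i).Carrier⟩ : Struc L) ∈ Q) ∧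
  (∀ (ι : Type u) (f : ι → Struc L) (U : Ultrafilter ι), (∀ i, f i ∈ Q) →
    (⟨(U : Filter ι).Product fun i => (f i).Carrier⟩ : Struc L) ∈ Q)

/-- `V` is a variety: closed under homomorphic images, substructures, and direct products. -/
def IsVariety (V : Set (Struc L)) : Prop :=
  (∀ A ∈ V, ∀ B : Struc L, ∀ f : A.Carrier →[L] B.Carrier, Function.Surjective f → B ∈ V) ∧
  (∀ B ∈ V, ∀ S : L.Substructure B.Carrier, ofSub B S ∈ V) ∧
  (∀ (ι : Type u) (f : ι → Struc L), (∀ i, f i ∈ V) →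
    (⟨∀ i, (f i).Carrier⟩ : Struc L) ∈ V)

variable {L}

/-- `Q` is relatively congruence-distributive: `Con_Q A` is a distributive lattice
for every `A ∈ Q`. -/
def RelCongDist (Q : Set (Struc L)) : Prop :=
  ∀ A ∈ Q, ∀ θ ∈ ConQ Q A, ∀ φ ∈ ConQ Q A, ∀ ψ ∈ ConQ Q A,
    θ ∩ joinQ Q A φ ψ = joinQ Q A (θ ∩ φ) (θ ∩ ψ)

/-- Relation composition `Θ ∘ Φ = {(a,c) : ∃ b, (a,b) ∈ Φ ∧ (b,c) ∈ Θ}`. -/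
def relComp {α : Type u} (Θ Φ : Set (α × α)) : Set (α × α) :=
  {p | ∃ b, (p.1, b) ∈ Φ ∧ (b, p.2) ∈ Θ}

/-- `Q` is relatively congruence-permutable. -/
def RelCongPerm (Q : Set (Struc L)) : Prop :=
  ∀ A ∈ Q, ∀ θ ∈ ConQ Q A, ∀ φ ∈ ConQ Q A, relComp θ φ = relComp φ θ

/-- A class `K` is closed under substructures. -/
def SubClosed (K : Set (Struc L)) : Prop :=
  ∀ B ∈ K, ∀ S : L.Substructure B.Carrier, ofSub B S ∈ K

/-- A class `K` is closed under isomorphisms. -/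
def IsoClosed (K : Set (Struc L)) : Prop :=
  ∀ A ∈ K, ∀ B : Struc L, Nonempty (A.Carrier ≃[L] B.Carrier) → B ∈ K

/-- A universal class: closed under isomorphisms, substructures, and ultraproducts. -/
def IsUniversalClass (K : Set (Struc L)) : Prop :=
  IsoClosed K ∧ SubClosed K ∧
  (∀ (ι : Type u) (f : ι → Struc L) (U : Ultrafilter ι), (∀ i, f i ∈ K) →
    (⟨(U : Filter ι).Product fun i => (f i).Carrier⟩ : Struc L) ∈ K)

/-- The extension property for a class `K`. -/
def HasEP (K : Set (Struc L)) : Prop :=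
  ∀ A ∈ K, ∀ B ∈ K, ∀ C ∈ K,
    ∀ (φB : A.Carrier →[L] B.Carrier) (φC : A.Carrier →[L] C.Carrier),
      Function.Injective φB → Function.Surjective φC →
      ∃ D ∈ K, ∃ (ψB : B.Carrier →[L] D.Carrier) (ψC : C.Carrier →[L] D.Carrier),
        Function.Injective ψC ∧ ∀ a, ψB (φB a) = ψC (φC a)

/-- The one-sided amalgamation property for a class `K`. -/
def Has1AP (K : Set (Struc L)) : Prop :=
  ∀ A ∈ K, ∀ B ∈ K, ∀ C ∈ K,
    ∀ (φB : A.Carrier →[L] B.Carrier) (φC : A.Carrier →[L] C.Carrier),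
      Function.Injective φB → Function.Injective φC →
      ∃ D ∈ K, ∃ (ψB : B.Carrier →[L] D.Carrier) (ψC : C.Carrier →[L] D.Carrier),
        Function.Injective ψC ∧ ∀ a, ψB (φB a) = ψC (φC a)

/-- Every doubly injective span in `K` has an amalgam in `K'`. -/
def HasAmalgamIn (K K' : Set (Struc L)) : Prop :=
  ∀ A ∈ K, ∀ B ∈ K, ∀ C ∈ K,
    ∀ (φB : A.Carrier →[L] B.Carrier) (φC : A.Carrier →[L] C.Carrier),
      Function.Injective φB → Function.Injective φC →
      ∃ D ∈ K', ∃ (ψB : B.Carrier →[L] D.Carrier) (ψC : C.Carrier →[L] D.Carrier),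
        Function.Injective ψB ∧ Function.Injective ψC ∧ ∀ a, ψB (φB a) = ψC (φC a)

/-- The amalgamation property for a class `K`. -/
def HasAP (K : Set (Struc L)) : Prop := HasAmalgamIn K K

/-- The transferable injections property for a class `K`. -/
def HasTIP (K : Set (Struc L)) : Prop :=
  ∀ A ∈ K, ∀ B ∈ K, ∀ C ∈ K,
    ∀ (φB : A.Carrier →[L] B.Carrier) (φC : A.Carrier →[L] C.Carrier),
      Function.Injective φB →
      ∃ D ∈ K, ∃ (ψB : B.Carrier →[L] D.Carrier) (ψC : C.Carrier →[L] D.Carrier),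
        Function.Injective ψC ∧ ∀ a, ψB (φB a) = ψC (φC a)

/-- Every doubly injective span in `K` has a strong amalgam in `K'`. -/
def HasStrongAmalgamIn (K K' : Set (Struc L)) : Prop :=
  ∀ A ∈ K, ∀ B ∈ K, ∀ C ∈ K,
    ∀ (φB : A.Carrier →[L] B.Carrier) (φC : A.Carrier →[L] C.Carrier),
      Function.Injective φB → Function.Injective φC →
      ∃ D ∈ K', ∃ (ψB : B.Carrier →[L] D.Carrier) (ψC : C.Carrier →[L] D.Carrier),
        Function.Injective ψB ∧ Function.Injective ψC ∧ (∀ a, ψB (φB a) = ψC (φC a)) ∧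
        Set.range (fun a => ψB (φB a)) = Set.range ψB ∩ Set.range ψC

/-- The strong amalgamation property for a class `K`. -/
def HasSAP (K : Set (Struc L)) : Prop := HasStrongAmalgamIn K K

/-- `φ : A → B` is an epimorphism in the class `K`. -/
def IsEpiIn (K : Set (Struc L)) {A B : Struc L} (φ : A.Carrier →[L] B.Carrier) : Prop :=
  ∀ C ∈ K, ∀ ψ₁ ψ₂ : B.Carrier →[L] C.Carrier,
    ψ₁.comp φ = ψ₂.comp φ → ψ₁ = ψ₂

/-- The class `K` has surjective epimorphisms. -/
def HasSE (K : Set (Struc L)) : Prop :=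
  ∀ A ∈ K, ∀ B ∈ K, ∀ φ : A.Carrier →[L] B.Carrier,
    IsEpiIn K φ → Function.Surjective φ

/-- A substructure `S` of `B` is a retract of `B`. -/
def IsRetract (B : Struc L) (S : L.Substructure B.Carrier) : Prop :=
  ∃ ψ : B.Carrier →[L] (ofSub B S).Carrier, ∀ a : (ofSub B S).Carrier, ψ (a : B.Carrier) = a


/-- The smallest variety containing `V₁ ∪ V₂`. -/
def varJoin (L : FirstOrder.Language.{u, u}) (V₁ V₂ : Set (Struc L)) : Set (Struc L) :=
  ⋂₀ {W | IsVariety L W ∧ V₁ ⊆ W ∧ V₂ ⊆ W}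

section Helpers

variable [L.IsAlgebraic]

/-- In an algebraic language, a surjective homomorphism `r` is a quotient map: every homomorphism
identifying the points identified by `r` factors through `r`. -/
theorem exists_hom_factor {A X Y : Type u} [L.Structure A] [L.Structure X] [L.Structure Y]
    (r : A →[L] X) (hr : Function.Surjective r) (q : A →[L] Y)
    (h : ∀ a b, r a = r b → q a = q b) : ∃ k : X →[L] Y, ∀ a, k (r a) = q a := by
  have hk : ∀ a, q (Function.surjInv hr (r a)) = q a := fun a =>
    h _ _ (Function.surjInv_eq hr _)
  refine ⟨⟨fun x => q (Function.surjInv hr x), fun {n} F x => ?_, fun R => isEmptyElim R⟩, hk⟩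
  have hx : x = r ∘ fun i => Function.surjInv hr (x i) :=
    funext fun i => (Function.surjInv_eq hr _).symm
  calc q (Function.surjInv hr (Structure.funMap F x))
      = q (Function.surjInv hr (r (Structure.funMap F fun i => Function.surjInv hr (x i)))) := by
        rw [r.map_fun, ← hx]
    _ = Structure.funMap F ((fun x => q (Function.surjInv hr x)) ∘ x) := by
        rw [hk, q.map_fun]; rfl

/-- The homomorphism into a product given by a family of homomorphisms. -/
def piHom {A : Type u} [L.Structure A] {ι : Type u} {M : ι → Type u} [∀ i, L.Structure (M i)]
    (f : ∀ i, A →[L] M i) : A →[L] (∀ i, M i) where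
  toFun a i := f i a
  map_fun' F x := funext fun i => (f i).map_fun F x
  map_rel' R := isEmptyElim R

/-- The homomorphism into an ultraproduct given by a family of homomorphisms. -/
def ultraHom {A : Type u} [L.Structure A] {ι : Type u} {M : ι → Type u} [∀ i, L.Structure (M i)]
    (U : Ultrafilter ι) (f : ∀ i, A →[L] M i) : A →[L] (U : Filter ι).Product M where
  toFun a := ((fun i => f i a : ∀ i, M i) : (U : Filter ι).Product M)
  map_fun' F x := by
    refine Eq.trans ?_ (Ultraproduct.funMap_cast F fun j i => f i (x j)).symm
    exact congrArg _ (funext fun i => (f i).map_fun F x)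
  map_rel' R := isEmptyElim R

theorem ultraHom_eq_iff {A : Type u} [L.Structure A] {ι : Type u} {M : ι → Type u}
    [∀ i, L.Structure (M i)] (U : Ultrafilter ι) (f : ∀ i, A →[L] M i) (a b : A) :
    ultraHom U f a = ultraHom U f b ↔ ∀ᶠ i in (U : Filter ι), f i a = f i b :=
  Quotient.eq

/-- In a class closed under ultraproducts, the union of a nonempty chain of relative congruences
is a relative congruence. -/
theorem sUnion_mem_ConQ {Q : Set (Struc L)} (hQ : IsQuasivariety L Q) (A : Struc L)
    {c : Set (Set (A.Carrier × A.Carrier))} (hcQ : c ⊆ ConQ Q A) (hc : IsChain (· ⊆ ·) c)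
    (hne : c.Nonempty) : ⋃₀ c ∈ ConQ Q A := by
  have hM : ∀ i : c, ∃ M ∈ Q, ∃ f : A.Carrier →[L] M.Carrier, (i : Set _) = kerSet f :=
    fun i => hcQ i.2
  choose M hMQ f hf using hM
  have : Nonempty c := hne.to_subtype
  have : IsDirected c (· ≤ ·) :=
    ⟨fun i j => (hc.total i.2 j.2).elim (fun h => ⟨j, h, le_rfl⟩) fun h => ⟨i, le_rfl, h⟩⟩
  let U : Ultrafilter c := Ultrafilter.of Filter.atTop
  refine ⟨_, hQ.2.2.2 c M U hMQ, ultraHom U f, ?_⟩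
  ext ⟨a, b⟩
  have hfi : ∀ i : c, f i a = f i b ↔ (a, b) ∈ (i : Set _) := fun i => by rw [hf i]; rfl
  change _ ↔ ultraHom U f a = ultraHom U f b
  rw [ultraHom_eq_iff]
  simp only [hfi]
  constructor
  · rintro ⟨i, hi, hab⟩
    refine Filter.Eventually.filter_mono (Ultrafilter.of_le _) ?_
    filter_upwards [Filter.eventually_ge_atTop (⟨i, hi⟩ : c)] with j hj
    exact hj hab
  · intro h
    obtain ⟨i, hi⟩ := h.exists
    exact ⟨i, i.2, hi⟩

/-- Distinct elements of a member of a quasivariety are separated by a homomorphism into a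
relatively subdirectly irreducible member. -/
theorem exists_hom_RSI_ne {Q : Set (Struc L)} (hQ : IsQuasivariety L Q) {B : Struc L} (hB : B ∈ Q)
    {b₁ b₂ : B.Carrier} (hb : b₁ ≠ b₂) :
    ∃ M ∈ RSI Q, ∃ f : B.Carrier →[L] M.Carrier, f b₁ ≠ f b₂ := by
  have hΔ : kerSet (Hom.id L B.Carrier) ∈ {θ | θ ∈ ConQ Q B ∧ (b₁, b₂) ∉ θ} :=
    ⟨⟨B, hB, Hom.id L B.Carrier, rfl⟩, hb⟩
  obtain ⟨θ, -, hmax⟩ := zorn_subset_nonempty {θ | θ ∈ ConQ Q B ∧ (b₁, b₂) ∉ θ}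
    (fun c hcS hc hne => ⟨⋃₀ c, ⟨sUnion_mem_ConQ hQ B (fun _ h => (hcS h).1) hc hne,
      fun ⟨t, ht, hbt⟩ => (hcS ht).2 hbt⟩, fun _ => subset_sUnion_of_mem⟩) _ hΔ
  obtain ⟨⟨M, hM, f, rfl⟩, hfb⟩ := hmax.prop
  let R : Struc L := ofSub M f.range
  have hR : R ∈ Q := hQ.2.1 M hM f.range
  let r : B.Carrier →[L] R.Carrier := f.codRestrict f.range f.mem_range_self
  have hr : ∀ a b, r a = r b ↔ f a = f b := fun a b => Subtype.ext_iff
  have hrs : ∀ y, ∃ x, r x = y := fun ⟨_, x, hx⟩ => ⟨x, Subtype.ext hx⟩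
  refine ⟨R, ⟨hR, ⟨R, hR, Hom.id L R.Carrier, rfl⟩, fun S hS hΔS => ?_⟩, r,
    fun h => hfb ((hr _ _).1 h)⟩
  have hrb : (r b₁, r b₂) ∉ ⋂₀ S := by
    rw [← hΔS]
    exact fun h => hfb ((hr _ _).1 h)
  obtain ⟨φ, hφS, hφ⟩ : ∃ φ ∈ S, (r b₁, r b₂) ∉ φ := by
    simpa only [mem_sInter, not_forall, exists_prop] using hrb
  obtain ⟨N, hN, g, rfl⟩ := hS hφS
  have hle : kerSet (g.comp r) ⊆ kerSet f := hmax.le_of_ge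
    ⟨⟨N, hN, g.comp r, rfl⟩, hφ⟩ fun p hp => congrArg g ((hr _ _).2 hp)
  have : diagonal R.Carrier = kerSet g := by
    ext ⟨x, y⟩
    obtain ⟨x, rfl⟩ := hrs x
    obtain ⟨y, rfl⟩ := hrs y
    exact ⟨fun h => congrArg g h, fun h => (hr x y).2 (@hle (x, y) h)⟩
  rw [this]
  exact hφS

/-- Under the hypotheses on `K`, distinct elements of `B` stay distinct in some completion in `Q`
of a doubly injective span `B ← A → C` in `Q`. -/
theorem exists_completion_ne {Q K : Set (Struc L)} (hQ : IsQuasivariety L Q)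
    (hK : SubClosed K) (hRSI : RSI Q ⊆ K)
    (hext : ∀ B ∈ Q, ∀ S : L.Substructure B.Carrier, ∀ C ∈ K,
      ∀ f : (ofSub B S).Carrier →[L] C.Carrier, Function.Surjective f →
        ∃ D ∈ K, ∃ g : B.Carrier →[L] D.Carrier, Function.Surjective g ∧
          restrict S (kerSet ⇑g) = kerSet ⇑f)
    (hAP : HasAmalgamIn K Q) {A B C : Struc L} (hB : B ∈ Q) (hC : C ∈ Q)
    (φB : A.Carrier →[L] B.Carrier) (φC : A.Carrier →[L] C.Carrier)
    (hφC : Function.Injective φC) {b₁ b₂ : B.Carrier} (hb : b₁ ≠ b₂) :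
    ∃ D ∈ Q, ∃ (ψB : B.Carrier →[L] D.Carrier) (ψC : C.Carrier →[L] D.Carrier),
      (∀ a, ψB (φB a) = ψC (φC a)) ∧ ψB b₁ ≠ ψB b₂ := by
  obtain ⟨M, hM, h, hne⟩ := exists_hom_RSI_ne hQ hB hb
  let m := h.comp φB
  let X : Struc L := ofSub M m.range
  have hX : X ∈ K := hK M (hRSI hM) m.range
  let r : A.Carrier →[L] X.Carrier := m.codRestrict m.range m.mem_range_self
  have hrs : Function.Surjective r := fun ⟨_, x, hx⟩ => ⟨x, Subtype.ext hx⟩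
  let s : A.Carrier →[L] (ofSub C φC.range).Carrier :=
    φC.codRestrict φC.range φC.mem_range_self
  obtain ⟨f, hf⟩ := exists_hom_factor s (fun ⟨_, x, hx⟩ => ⟨x, Subtype.ext hx⟩) r
    fun a b hab => congrArg r (hφC (Subtype.ext_iff.1 hab))
  have hfs : Function.Surjective f := fun y => by
    obtain ⟨a, rfl⟩ := hrs y
    exact ⟨s a, hf a⟩
  obtain ⟨D, hD, g, -, hgf⟩ := hext C hC φC.range X hX f hfs
  have hker : ∀ a b, g (φC a) = g (φC b) ↔ r a = r b := fun a b => by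
    rw [← hf, ← hf]
    exact Set.ext_iff.1 hgf (s a, s b)
  obtain ⟨k, hk⟩ := exists_hom_factor r hrs (g.comp φC) fun a b => (hker a b).2
  have hki : Function.Injective k := fun x y hxy => by
    obtain ⟨a, rfl⟩ := hrs x
    obtain ⟨b, rfl⟩ := hrs y
    rw [hk, hk] at hxy
    exact (hker a b).1 hxy
  obtain ⟨E, hE, ψM, ψD, hψM, -, hcomm⟩ :=
    hAP X hX M (hRSI hM) D hD m.range.subtype.toHom k Subtype.val_injective hki
  exact ⟨E, hE, ψM.comp h, ψD.comp g,
    fun a => (hcomm (r a)).trans (congrArg ψD (hk a)), fun heq => hne (hψM heq)⟩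

end Helpers

/-- Proposition 3.2: sufficient conditions on a subclass `K` of a quasivariety
`Q` for `Q` to have the amalgamation property. -/
theorem stmt12 (L : FirstOrder.Language.{u, u}) [L.IsAlgebraic]
    (Q K : Set (Struc L)) (hQ : IsQuasivariety L Q) (hKQ : K ⊆ Q)
    (h1 : IsoClosed K) (h1' : SubClosed K)
    (h2 : RSI Q ⊆ K)
    (h3 : ∀ B ∈ Q, ∀ S : L.Substructure B.Carrier, ∀ C ∈ K,
      ∀ f : (ofSub B S).Carrier →[L] C.Carrier, Function.Surjective f →
        ∃ D ∈ K, ∃ g : B.Carrier →[L] D.Carrier, Function.Surjective g ∧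
          restrict S (kerSet ⇑g) = kerSet ⇑f)
    (h4 : HasAmalgamIn K Q) :
    HasAP Q := by
  intro A _ B hB C hC φB φC hφB hφC
  have hsep : ∀ i : {p : B.Carrier × B.Carrier // p.1 ≠ p.2} ⊕
      {p : C.Carrier × C.Carrier // p.1 ≠ p.2},
      ∃ D ∈ Q, ∃ (ψB : B.Carrier →[L] D.Carrier) (ψC : C.Carrier →[L] D.Carrier),
        (∀ a, ψB (φB a) = ψC (φC a)) ∧
          Sum.elim (fun p => ψB p.1.1 ≠ ψB p.1.2) (fun p => ψC p.1.1 ≠ ψC p.1.2) i := by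
    rintro (p | p)
    · exact exists_completion_ne hQ h1' h2 h3 h4 hB hC φB φC hφC p.2
    · obtain ⟨D, hD, ψC, ψB, hψ, hne⟩ :=
        exists_completion_ne hQ h1' h2 h3 h4 hC hB φC φB hφB p.2
      exact ⟨D, hD, ψB, ψC, fun a => (hψ a).symm, hne⟩
  choose D hD ψB ψC hψ hne using hsep
  refine ⟨_, hQ.2.2.1 _ D hD, piHom ψB, piHom ψC, fun x y hxy => ?_, fun x y hxy => ?_,
    fun a => funext fun i => hψ i a⟩
  · by_contra h
    exact hne (.inl ⟨(x, y), h⟩) (congrFun hxy _)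
  · by_contra h
    exact hne (.inr ⟨(x, y), h⟩) (congrFun hxy _)

end Transfer
end

section
/- Let Q be a quasivariety that has the Q-congruence extension property and such that Q_RFSI is closed under substructures. Then the following are equivalent: (1) Q has the amalgamation property; (2) Q has the one-sided amalgamation property; (3) Q_RFSI has the one-sided amalgamation property; (4) every doubly injective span in Q_RFSI has an amalgam (D,ψ_B,ψ_C) in which D is a direct product D₁ × D₂ of two members of Q_RFSI; (5) every doubly injective span in Q_RFSI has an amalgam in Q. -/
open FirstOrder Language Set

universe u

namespace Transfer

variable (L : FirstOrder.Language.{u, u})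

variable {L}

variable (L)

variable {L}

section Helpers

variable {Q : Set (Struc L)}

/-- Over an algebraic language a map preserving the operations is a homomorphism. -/
def algHom [L.IsAlgebraic] {M N : Type u} [L.Structure M] [L.Structure N] (f : M → N)
    (hf : ∀ {n} (F : L.Functions n) (x : Fin n → M),
      f (Structure.funMap F x) = Structure.funMap F (f ∘ x)) : M →[L] N where
  toFun := f
  map_fun' := hf
  map_rel' r := isEmptyElim r

/-- Pairing of homomorphisms into a binary product. -/
def pairHom [L.IsAlgebraic] {A M N : Type u} [L.Structure A] [L.Structure M] [L.Structure N]
    (f : A →[L] M) (g : A →[L] N) : A →[L] (M × N) :=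
  algHom (fun a => (f a, g a)) fun F x => Prod.ext (f.map_fun F x) (g.map_fun F x)

/-- The homomorphism into a product given by a family of homomorphisms. -/
def tupleHom [L.IsAlgebraic] {A : Type u} [L.Structure A] {ι : Type u} {M : ι → Type u}
    [∀ i, L.Structure (M i)] (f : ∀ i, A →[L] M i) : A →[L] (∀ i, M i) :=
  algHom (fun a i => f i a) fun F x => funext fun i => (f i).map_fun F x

theorem prod_mem [L.IsAlgebraic] (hQ : IsQuasivariety L Q) {D₁ D₂ : Struc L} (h₁ : D₁ ∈ Q)
    (h₂ : D₂ ∈ Q) : (⟨D₁.Carrier × D₂.Carrier⟩ : Struc L) ∈ Q := by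
  let f : ULift.{u} Bool → Struc L := fun b => cond b.down D₁ D₂
  have hf : ∀ i, f i ∈ Q := by rintro ⟨_ | _⟩ <;> assumption
  refine hQ.1 _ (hQ.2.2.1 _ f hf) _ ⟨?_⟩
  exact
    { toFun := fun x => (x ⟨true⟩, x ⟨false⟩)
      invFun := fun y i => match i with
        | ⟨true⟩ => y.1
        | ⟨false⟩ => y.2
      left_inv := fun x => by
        funext i
        rcases i with ⟨_ | _⟩ <;> rfl
      right_inv := fun y => rfl
      map_fun' := fun F x => rfl
      map_rel' := fun r => isEmptyElim r }

/-- A homomorphism whose kernel contains that of a surjective one factors through it. -/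
theorem exists_factor [L.IsAlgebraic] {A M N : Type u} [L.Structure A] [L.Structure M]
    [L.Structure N] (h : A →[L] M) (hh : Function.Surjective h) (k : A →[L] N)
    (hk : kerSet h ⊆ kerSet k) : ∃ j : M →[L] N, ∀ a, j (h a) = k a := by
  have key : ∀ a, k (Function.surjInv hh (h a)) = k a := fun a =>
    @hk (_, _) (Function.surjInv_eq hh (h a))
  refine ⟨algHom (fun m => k (Function.surjInv hh m)) fun F x => ?_, key⟩
  have hx : x = h ∘ fun i => Function.surjInv hh (x i) :=
    funext fun i => (Function.surjInv_eq hh (x i)).symm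
  conv_lhs => rw [hx, ← h.map_fun F, key, k.map_fun F]
  rfl

theorem kerSet_mem {A M : Struc L} (hM : M ∈ Q) (f : A.Carrier →[L] M.Carrier) :
    kerSet f ∈ ConQ Q A := ⟨M, hM, f, rfl⟩

theorem diagonal_mem {A : Struc L} (hA : A ∈ Q) : Set.diagonal A.Carrier ∈ ConQ Q A :=
  ⟨A, hA, Hom.id L _, rfl⟩

theorem preimage_mem {A B : Struc L} {Φ : Set (B.Carrier × B.Carrier)} (hΦ : Φ ∈ ConQ Q B)
    (i : A.Carrier →[L] B.Carrier) : Prod.map i i ⁻¹' Φ ∈ ConQ Q A := by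
  obtain ⟨M, hM, f, rfl⟩ := hΦ
  exact ⟨M, hM, f.comp i, rfl⟩

/-- The union of a nonempty chain of `Q`-congruences is a `Q`-congruence. -/
theorem sUnion_chain_mem [L.IsAlgebraic] (hQ : IsQuasivariety L Q) {A : Struc L}
    {c : Set (Set (A.Carrier × A.Carrier))} (hc : c ⊆ ConQ Q A) (hch : IsChain (· ⊆ ·) c)
    (hne : c.Nonempty) : ⋃₀ c ∈ ConQ Q A := by
  have hc' : ∀ i : c, ∃ M ∈ Q, ∃ f : A.Carrier →[L] M.Carrier, i.1 = kerSet f := fun i => hc i.2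
  choose M hM f hf using hc'
  have : Nonempty c := hne.to_subtype
  have : IsDirectedOrder c := ⟨fun x y => by
    rcases hch.total x.2 y.2 with h | h
    · exact ⟨y, h, le_rfl⟩
    · exact ⟨x, le_rfl, h⟩⟩
  let U : Ultrafilter c := Ultrafilter.of Filter.atTop
  have hU : (U : Filter c) ≤ Filter.atTop := Ultrafilter.of_le _
  let g : A.Carrier →[L] (U : Filter c).Product fun i => (M i).Carrier :=
    algHom (fun a => Quotient.mk'' fun i : c => f i a) fun F x => by
      change _ = Structure.funMap F fun j => (Quotient.mk'' fun i : c => f i (x j) :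
        (U : Filter c).Product fun i => (M i).Carrier)
      refine Eq.trans ?_ (Ultraproduct.funMap_cast F fun j (i : c) => f i (x j)).symm
      congr 1
      funext i
      exact (f i).map_fun F x
  refine ⟨_, hQ.2.2.2 c (fun i => M i) U fun i => hM i, g, ?_⟩
  ext ⟨a, b⟩
  have hg : (a, b) ∈ kerSet g ↔ ∀ᶠ i : c in U, f i a = f i b := Quotient.eq''
  rw [hg]
  constructor
  · rintro ⟨θ, hθ, hab⟩
    filter_upwards [hU (Filter.mem_atTop (⟨θ, hθ⟩ : c))] with φ hφ
    have : (a, b) ∈ φ.1 := hφ hab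
    rw [hf φ] at this
    exact this
  · intro h
    obtain ⟨φ, hφ⟩ := h.exists
    refine ⟨φ.1, φ.2, ?_⟩
    rw [hf φ]
    exact hφ

/-- Among the `Q`-congruences with a prescribed trace on `R` there are maximal ones. -/
theorem exists_maximal_trace [L.IsAlgebraic] (hQ : IsQuasivariety L Q) {A : Struc L}
    {Φ₀ : Set (A.Carrier × A.Carrier)} (hΦ₀ : Φ₀ ∈ ConQ Q A) (R : Set (A.Carrier × A.Carrier)) :
    ∃ Φ ∈ ConQ Q A, Φ₀ ⊆ Φ ∧ Φ ∩ R ⊆ Φ₀ ∧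
      ∀ Ψ ∈ ConQ Q A, Φ ⊆ Ψ → Ψ ∩ R ⊆ Φ₀ → Φ = Ψ := by
  obtain ⟨Φ, h0, hmax⟩ := zorn_subset_nonempty {Φ | Φ ∈ ConQ Q A ∧ Φ ∩ R ⊆ Φ₀}
    (fun c hc hch hne => ⟨⋃₀ c,
      ⟨sUnion_chain_mem hQ (fun _ h => (hc h).1) hch hne, by
        rintro p ⟨⟨θ, hθ, hp⟩, hR⟩
        exact (hc hθ).2 ⟨hp, hR⟩⟩,
      fun _ h => subset_sUnion_of_mem h⟩)
    Φ₀ ⟨hΦ₀, inter_subset_left⟩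
  exact ⟨Φ, hmax.prop.1, h0, hmax.prop.2, fun Ψ hΨ hle hR => hmax.eq_of_subset ⟨hΨ, hR⟩ hle⟩

/-- A meet-irreducible `Q`-congruence is the kernel of a surjection onto a relatively finitely
subdirectly irreducible structure. -/
theorem MeetIrred.exists_surjective (hQ : IsQuasivariety L Q) {A : Struc L}
    {θ : Set (A.Carrier × A.Carrier)} (hθ : MeetIrred Q A θ) :
    ∃ M ∈ RFSI Q, ∃ f : A.Carrier →[L] M.Carrier, Function.Surjective f ∧ θ = kerSet f := by
  obtain ⟨⟨M, hM, f, rfl⟩, hirr⟩ := hθ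
  have hN : ofSub M f.range ∈ Q := hQ.2.1 M hM _
  let f' : A.Carrier →[L] f.range := f.codRestrict f.range fun a => ⟨a, rfl⟩
  have hs : Function.Surjective f' := by
    rintro ⟨_, a, rfl⟩
    exact ⟨a, rfl⟩
  have hker : kerSet f = kerSet f' := by
    ext p
    exact (Subtype.ext_iff (a1 := f' p.1) (a2 := f' p.2)).symm
  refine ⟨ofSub M f.range, ⟨hN, diagonal_mem hN, fun θ₁ h₁ θ₂ h₂ h => ?_⟩, f', hs, hker⟩
  have pull : ∀ ψ : Set (f.range × f.range), kerSet f = Prod.map f' f' ⁻¹' ψ →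
      Set.diagonal f.range = ψ := by
    intro ψ hψ
    rw [hker] at hψ
    ext ⟨x, y⟩
    obtain ⟨a, rfl⟩ := hs x
    obtain ⟨b, rfl⟩ := hs y
    exact Set.ext_iff.1 hψ (a, b)
  refine (hirr _ (preimage_mem h₁ f') _ (preimage_mem h₂ f') ?_).imp (pull _) (pull _)
  rw [← preimage_inter, ← h, hker]
  rfl

theorem meetIrred_kerSet [L.IsAlgebraic] {A M : Struc L} (hM : M ∈ RFSI Q)
    (h : A.Carrier →[L] M.Carrier) (hh : Function.Surjective h) : MeetIrred Q A (kerSet h) := by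
  refine ⟨kerSet_mem hM.1 h, ?_⟩
  rintro _ ⟨M₁, hM₁, g₁, rfl⟩ _ ⟨M₂, hM₂, g₂, rfl⟩ heq
  obtain ⟨j₁, hj₁⟩ := exists_factor h hh g₁ (heq.subset.trans inter_subset_left)
  obtain ⟨j₂, hj₂⟩ := exists_factor h hh g₂ (heq.subset.trans inter_subset_right)
  have back : ∀ {N : Type u} (j : M.Carrier → N) (g : A.Carrier → N), (∀ a, j (h a) = g a) →
      Set.diagonal M.Carrier = kerSet j → kerSet h = kerSet g := by
    intro N j g hj hd
    ext ⟨a, b⟩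
    have := Set.ext_iff.1 hd (h a, h b)
    simpa [kerSet, hj] using this
  refine (hM.2.2 _ (kerSet_mem hM₁ j₁) _ (kerSet_mem hM₂ j₂) ?_).imp
    (back j₁ g₁ hj₁) (back j₂ g₂ hj₂)
  ext ⟨x, y⟩
  obtain ⟨a, rfl⟩ := hh x
  obtain ⟨b, rfl⟩ := hh y
  have := Set.ext_iff.1 heq (a, b)
  simpa [kerSet, hj₁, hj₂] using this

/-- If a `Q`-congruence of `B` pulls back to a meet-irreducible one along `i : A → B`, then the
pullback is also that of the kernel of a homomorphism from `B` to a member of `Q_RFSI`. -/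
theorem exists_RFSI_extension [L.IsAlgebraic] (hQ : IsQuasivariety L Q) {A B : Struc L}
    (i : A.Carrier →[L] B.Carrier) {Φ₀ : Set (B.Carrier × B.Carrier)} (hΦ₀ : Φ₀ ∈ ConQ Q B)
    (hθ : MeetIrred Q A (Prod.map i i ⁻¹' Φ₀)) :
    ∃ M ∈ RFSI Q, ∃ g : B.Carrier →[L] M.Carrier,
      Prod.map i i ⁻¹' Φ₀ = kerSet fun a => g (i a) := by
  obtain ⟨Φ, hΦ, h0, hR, hmax⟩ := exists_maximal_trace hQ hΦ₀ (Set.range (Prod.map i i))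
  have hpull : Prod.map i i ⁻¹' Φ₀ = Prod.map i i ⁻¹' Φ :=
    Subset.antisymm (preimage_mono h0) fun p hp => hR ⟨hp, p, rfl⟩
  have hirr : MeetIrred Q B Φ := by
    refine ⟨hΦ, fun Φ₁ h₁ Φ₂ h₂ h => ?_⟩
    have key : ∀ Ψ ∈ ConQ Q B, Φ ⊆ Ψ →
        Prod.map i i ⁻¹' Φ₀ = Prod.map i i ⁻¹' Ψ → Φ = Ψ := by
      intro Ψ hΨ hle he
      refine hmax Ψ hΨ hle ?_
      rintro _ ⟨hp, p, rfl⟩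
      exact he.superset hp
    refine (hθ.2 _ (preimage_mem h₁ i) _ (preimage_mem h₂ i) ?_).imp
      (key _ h₁ (h.subset.trans inter_subset_left))
      (key _ h₂ (h.subset.trans inter_subset_right))
    rw [hpull, h, preimage_inter]
  obtain ⟨M, hM, g, -, rfl⟩ := hirr.exists_surjective hQ
  exact ⟨M, hM, g, hpull⟩

/-- Distinct elements are separated by a homomorphism to a member of `Q_RFSI`. -/
theorem exists_RFSI_separating [L.IsAlgebraic] (hQ : IsQuasivariety L Q) {A : Struc L}
    (hA : A ∈ Q) {a b : A.Carrier} (hab : a ≠ b) :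
    ∃ M ∈ RFSI Q, ∃ g : A.Carrier →[L] M.Carrier, g a ≠ g b := by
  obtain ⟨Φ, hΦ, -, hR, hmax⟩ := exists_maximal_trace hQ (diagonal_mem hA) {(a, b)}
  have hirr : MeetIrred Q A Φ := by
    refine ⟨hΦ, fun Φ₁ h₁ Φ₂ h₂ h => ?_⟩
    have key : ∀ Ψ ∈ ConQ Q A, Φ ⊆ Ψ → (a, b) ∉ Ψ → Φ = Ψ := by
      intro Ψ hΨ hle hn
      refine hmax Ψ hΨ hle ?_
      rintro _ ⟨hp, rfl⟩
      exact absurd hp hn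
    by_cases ha : (a, b) ∈ Φ₁
    · exact .inr (key _ h₂ (h.subset.trans inter_subset_right) fun hb =>
        hab (hR ⟨h.superset ⟨ha, hb⟩, rfl⟩))
    · exact .inl (key _ h₁ (h.subset.trans inter_subset_left) ha)
  obtain ⟨M, hM, g, -, rfl⟩ := hirr.exists_surjective hQ
  exact ⟨M, hM, g, fun h => hab (hR ⟨h, rfl⟩)⟩

/-- The congruence extension property along an injective homomorphism. -/
theorem HasQCEP.exists_extension [L.IsAlgebraic] {A B : Struc L} (hB : HasQCEP Q B)
    (i : A.Carrier →[L] B.Carrier) (hi : Function.Injective i)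
    {θ : Set (A.Carrier × A.Carrier)} (hθ : θ ∈ ConQ Q A) :
    ∃ Φ ∈ ConQ Q B, Prod.map i i ⁻¹' Φ = θ := by
  obtain ⟨M, hM, h, rfl⟩ := hθ
  let i' : A.Carrier →[L] i.range := i.codRestrict i.range fun a => ⟨a, rfl⟩
  have hs : Function.Surjective i' := by
    rintro ⟨_, a, rfl⟩
    exact ⟨a, rfl⟩
  obtain ⟨j, hj⟩ := exists_factor i' hs h fun p hp =>
    congrArg h (hi (Subtype.ext_iff.1 hp))
  obtain ⟨Φ, hΦ, hr⟩ := hB i.range (kerSet j) ⟨M, hM, j, rfl⟩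
  refine ⟨Φ, hΦ, ?_⟩
  ext ⟨a, b⟩
  have := Set.ext_iff.1 hr (i' a, i' b)
  simp only [kerSet, mem_ofPred_eq, hj] at this
  exact this

/-- One-sided amalgamation in two directions combines to an amalgam in a binary product. -/
theorem Has1AP.exists_prod_amalgam [L.IsAlgebraic] {K : Set (Struc L)} (hK : Has1AP K)
    {A B C : Struc L} (hA : A ∈ K) (hB : B ∈ K) (hC : C ∈ K)
    (φB : A.Carrier →[L] B.Carrier) (φC : A.Carrier →[L] C.Carrier)
    (hφB : Function.Injective φB) (hφC : Function.Injective φC) :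
    ∃ D₁ ∈ K, ∃ D₂ ∈ K,
      ∃ (ψB : B.Carrier →[L] (D₁.Carrier × D₂.Carrier))
        (ψC : C.Carrier →[L] (D₁.Carrier × D₂.Carrier)),
        Function.Injective ψB ∧ Function.Injective ψC ∧ ∀ a, ψB (φB a) = ψC (φC a) := by
  obtain ⟨D₁, h₁, fB, fC, hfC, hf⟩ := hK A hA B hB C hC φB φC hφB hφC
  obtain ⟨D₂, h₂, gC, gB, hgB, hg⟩ := hK A hA C hC B hB φC φB hφC hφB
  exact ⟨D₁, h₁, D₂, h₂, pairHom fB gB, pairHom fC gC,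
    fun x y h => hgB (congrArg Prod.snd h), fun x y h => hfC (congrArg Prod.fst h),
    fun a => Prod.ext (hf a) (hg a).symm⟩

theorem Has1AP.hasAP [L.IsAlgebraic] (hQ : IsQuasivariety L Q) (h : Has1AP Q) : HasAP Q := by
  intro A hA B hB C hC φB φC hφB hφC
  obtain ⟨D₁, h₁, D₂, h₂, ψB, ψC, hψ⟩ := h.exists_prod_amalgam hA hB hC φB φC hφB hφC
  exact ⟨_, prod_mem hQ h₁ h₂, ψB, ψC, hψ⟩

theorem HasAmalgamIn.has1AP_RFSI [L.IsAlgebraic] (hQ : IsQuasivariety L Q)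
    (h : HasAmalgamIn (RFSI Q) Q) : Has1AP (RFSI Q) := by
  intro A hA B hB C hC φB φC hφB hφC
  obtain ⟨D, hD, ψB, ψC, -, hψC, hψ⟩ := h A hA B hB C hC φB φC hφB hφC
  have hdiag : Prod.map ψC ψC ⁻¹' Set.diagonal D.Carrier = Set.diagonal C.Carrier := by
    ext p
    exact hψC.eq_iff
  obtain ⟨M, hM, g, hg⟩ := exists_RFSI_extension hQ ψC (diagonal_mem hD) (hdiag ▸ hC.2)
  refine ⟨M, hM, g.comp ψB, g.comp ψC, fun x y hxy => ?_, fun a => congrArg g (hψ a)⟩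
  have : (x, y) ∈ Prod.map ψC ψC ⁻¹' Set.diagonal D.Carrier := hg.superset hxy
  exact hψC this

/-- One-sided amalgamation lifts from `Q_RFSI` to `Q`. -/
theorem Has1AP.of_RFSI [L.IsAlgebraic] (hQ : IsQuasivariety L Q) (hcep : ClassQCEP Q Q)
    (hs : SubClosed (RFSI Q)) (h : Has1AP (RFSI Q)) : Has1AP Q := by
  intro A hA B hB C hC φB φC hφB hφC
  have key : ∀ p : {p : C.Carrier × C.Carrier // p.1 ≠ p.2}, ∃ D ∈ Q,
      ∃ (ψB : B.Carrier →[L] D.Carrier) (ψC : C.Carrier →[L] D.Carrier),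
        ψC p.1.1 ≠ ψC p.1.2 ∧ ∀ a, ψB (φB a) = ψC (φC a) := by
    rintro ⟨⟨c, d⟩, hcd⟩
    obtain ⟨C', hC', f, hf⟩ := exists_RFSI_separating hQ hC hcd
    let k := f.comp φC
    let A' : Struc L := ofSub C' k.range
    have hA' : A' ∈ RFSI Q := hs C' hC' _
    let k' : A.Carrier →[L] A'.Carrier := k.codRestrict k.range fun a => ⟨a, rfl⟩
    have hk' : Function.Surjective k' := by
      rintro ⟨_, a, rfl⟩
      exact ⟨a, rfl⟩
    have hirr : MeetIrred Q A (kerSet k') := meetIrred_kerSet hA' k' hk'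
    obtain ⟨Φ₀, hΦ₀, hΦ₀k⟩ := (hcep B hB).exists_extension φB hφB hirr.1
    obtain ⟨B', hB', g, hg⟩ := exists_RFSI_extension hQ φB hΦ₀ (hΦ₀k.symm ▸ hirr)
    rw [hΦ₀k] at hg
    obtain ⟨j, hj⟩ := exists_factor k' hk' (g.comp φB) hg.subset
    have hj_inj : Function.Injective j := by
      intro x y hxy
      obtain ⟨a, rfl⟩ := hk' x
      obtain ⟨b, rfl⟩ := hk' y
      rw [hj, hj] at hxy
      have hab : (a, b) ∈ kerSet k' := hg.superset hxy
      exact hab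
    obtain ⟨D, hD, ψB, ψC, hψC, hψ⟩ := h A' hA' B' hB' C' hC' j k.range.subtype.toHom hj_inj
      Subtype.val_injective
    refine ⟨D, hD.1, ψB.comp g, ψC.comp f, fun he => hf (hψC he), fun a => ?_⟩
    have := hψ (k' a)
    rw [hj] at this
    exact this
  choose D hD ψB ψC hne hψ using key
  refine ⟨_, hQ.2.2.1 _ D hD, tupleHom ψB, tupleHom ψC, fun c d hcd => ?_,
    fun a => funext fun p => hψ p a⟩
  by_contra hn
  exact hne ⟨(c, d), hn⟩ (congrFun hcd _)

end Helpers

/-- Theorem 3.3: for a quasivariety `Q` with the `Q`-CEP such that `Q_RFSI` is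
closed under substructures, the five amalgamation conditions are equivalent. -/
theorem stmt13 (L : FirstOrder.Language.{u, u}) [L.IsAlgebraic]
    (Q : Set (Struc L)) (hQ : IsQuasivariety L Q)
    (hcep : ClassQCEP Q Q) (hs : SubClosed (RFSI Q)) :
    List.TFAE [HasAP Q, Has1AP Q, Has1AP (RFSI Q),
      ∀ A ∈ RFSI Q, ∀ B ∈ RFSI Q, ∀ C ∈ RFSI Q,
        ∀ (φB : A.Carrier →[L] B.Carrier) (φC : A.Carrier →[L] C.Carrier),
          Function.Injective φB → Function.Injective φC →
          ∃ D₁ ∈ RFSI Q, ∃ D₂ ∈ RFSI Q,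
            ∃ (ψB : B.Carrier →[L] (D₁.Carrier × D₂.Carrier))
              (ψC : C.Carrier →[L] (D₁.Carrier × D₂.Carrier)),
              Function.Injective ψB ∧ Function.Injective ψC ∧
                ∀ a, ψB (φB a) = ψC (φC a),
      HasAmalgamIn (RFSI Q) Q] := by
  tfae_have 2 → 1 := Has1AP.hasAP hQ
  tfae_have 1 → 5 := fun h A hA B hB C hC => h A hA.1 B hB.1 C hC.1
  tfae_have 5 → 3 := HasAmalgamIn.has1AP_RFSI hQ
  tfae_have 3 → 2 := Has1AP.of_RFSI hQ hcep hs
  tfae_have 3 → 4 := fun h A hA B hB C hC φB φC hφB hφC =>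
    h.exists_prod_amalgam hA hB hC φB φC hφB hφC
  tfae_have 4 → 5 := fun h A hA B hB C hC φB φC hφB hφC => by
    obtain ⟨D₁, h₁, D₂, h₂, hψ⟩ := h A hA B hB C hC φB φC hφB hφC
    exact ⟨_, prod_mem hQ h₁.1 h₂.1, hψ⟩
  tfae_finish

end Transfer
end

section
/- Let K be a class of L-structures that is closed under substructures. Then K has the transferable injections property if and only if K has the one-sided amalgamation property and the extension property. -/
open FirstOrder Language Set

universe u

namespace Transfer

variable (L : FirstOrder.Language.{u, u})

variable {L}

variable (L)

variable {L}

/-- Proposition 4.1: a class closed under substructures has the TIP iff it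
has the 1AP and the EP. -/
theorem stmt15 (L : FirstOrder.Language.{u, u}) [L.IsAlgebraic]
    (K : Set (Struc L)) (h : SubClosed K) :
    HasTIP K ↔ Has1AP K ∧ HasEP K := by
  refine ⟨fun hT => ⟨fun A hA B hB C hC φB φC hφB _ => hT A hA B hB C hC φB φC hφB,
    fun A hA B hB C hC φB φC hφB _ => hT A hA B hB C hC φB φC hφB⟩, ?_⟩
  rintro ⟨hAP, hEP⟩ A hA B hB C hC φB φC hφB
  -- Factor `φC` through its range: extend along `A → range φC`, then amalgamate over the range.
  have hS := h C hC φC.range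
  obtain ⟨D, hD, ψB, ψS, hψS, hBS⟩ := hEP A hA B hB (ofSub C φC.range) hS φB
    (φC.codRestrict φC.range fun a => ⟨a, rfl⟩) hφB
    (by rintro ⟨_, a, rfl⟩; exact ⟨a, rfl⟩)
  obtain ⟨E, hE, χD, χC, hχC, hDC⟩ := hAP (ofSub C φC.range) hS D hD C hC ψS
    φC.range.subtype.toHom hψS Subtype.val_injective
  exact ⟨E, hE, χD.comp ψB, χC, hχC, fun a => (congrArg χD (hBS a)).trans (hDC _)⟩

end Transfer
end

section
/- If a quasivariety Q has the transferable injections property, then Q_RFSI has the transferable injections property. -/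
open FirstOrder Language Set

universe u

namespace Transfer

variable (L : FirstOrder.Language.{u, u})

variable {L}

variable (L)

variable {L}

/-- The union of a nonempty chain of `Q`-congruences is a `Q`-congruence. -/
theorem sUnion_mem_conQ {L : FirstOrder.Language.{u, u}} [L.IsAlgebraic] {Q : Set (Struc L)}
    (hQ : IsQuasivariety L Q) {D : Struc L} {c : Set (Set (D.Carrier × D.Carrier))}
    (hc : c ⊆ ConQ Q D) (hchain : IsChain (· ⊆ ·) c) (hne : c.Nonempty) :
    ⋃₀ c ∈ ConQ Q D := by
  choose M hM f hf using fun i : c => hc i.2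
  have : Nonempty c := hne.to_subtype
  have : IsDirectedOrder c :=
    ⟨fun a b => (hchain.total a.2 b.2).elim (fun h => ⟨b, h, le_rfl⟩) fun h => ⟨a, le_rfl, h⟩⟩
  let U : Ultrafilter c := Ultrafilter.of Filter.atTop
  let g : D.Carrier →[L] (U : Filter c).Product fun i => (M i).Carrier :=
    { toFun := fun d => Quotient.mk _ fun i => f i d
      map_fun' := fun F x => by
        refine Eq.trans ?_ (Ultraproduct.funMap_cast F fun j i => f i (x j)).symm
        simp only [Hom.map_fun, Function.comp_def]
        rfl
      map_rel' := fun r => isEmptyElim r }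
  refine ⟨_, hQ.2.2.2 c M U hM, g, ?_⟩
  ext ⟨a, b⟩
  have key : (a, b) ∈ kerSet g ↔ ∀ᶠ i : c in (U : Filter c), (a, b) ∈ (i : Set _) := by
    refine Quotient.eq.trans (Filter.eventually_congr (Filter.Eventually.of_forall fun i => ?_))
    rw [hf i]
    rfl
  rw [key]
  constructor
  · rintro ⟨θ, hθ, hab⟩
    exact Ultrafilter.of_le _
      ((Filter.eventually_ge_atTop (⟨θ, hθ⟩ : c)).mono fun i hi => hi hab)
  · intro hev
    obtain ⟨i, hi⟩ := hev.exists
    exact ⟨i, i.2, hi⟩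

/-- Every embedding of a relatively finitely subdirectly irreducible structure into a member
of `Q` can be followed by a homomorphism onto a relatively finitely subdirectly irreducible
structure so that the composite is still injective. -/
theorem exists_hom_rfsi_injective_comp {L : FirstOrder.Language.{u, u}} [L.IsAlgebraic]
    {Q : Set (Struc L)} (hQ : IsQuasivariety L Q) {C D : Struc L} (hC : C ∈ RFSI Q) (hD : D ∈ Q)
    (ψ : C.Carrier →[L] D.Carrier) (hψ : Function.Injective ψ) :
    ∃ E ∈ RFSI Q, ∃ π : D.Carrier →[L] E.Carrier, Function.Injective (π ∘ ψ) := by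
  obtain ⟨Θ, -, hmax⟩ := zorn_subset_nonempty
    {θ | θ ∈ ConQ Q D ∧ ∀ x y, (ψ x, ψ y) ∈ θ → x = y}
    (fun c hc hchain hne => ⟨⋃₀ c, ⟨sUnion_mem_conQ hQ (fun θ hθ => (hc hθ).1) hchain hne,
      fun x y ⟨θ, hθ, hxy⟩ => (hc hθ).2 x y hxy⟩, fun θ hθ => subset_sUnion_of_mem hθ⟩)
    (kerSet (Hom.id L D.Carrier)) ⟨⟨D, hD, Hom.id L _, rfl⟩, fun x y hxy => hψ hxy⟩
  obtain ⟨⟨M, hM, f, rfl⟩, hΘ⟩ := hmax.prop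
  let π : D.Carrier →[L] f.range := f.codRestrict f.range fun d => ⟨d, rfl⟩
  have hE : ofSub M f.range ∈ Q := hQ.2.1 M hM f.range
  have hπ (a b : D.Carrier) : π a = π b ↔ f a = f b := Subtype.ext_iff
  have hsurj : Function.Surjective π := fun ⟨_, d, hd⟩ => ⟨d, Subtype.ext hd⟩
  have hinj : Function.Injective (π ∘ ψ) := fun x y hxy => hΘ x y ((hπ _ _).1 hxy)
  have hker {N : Struc L} (hN : N ∈ Q) (g : f.range →[L] N.Carrier)
      (hg : diagonal C.Carrier = kerSet (g.comp (π.comp ψ))) :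
      diagonal f.range = kerSet g := by
    have hle := hmax.le_of_ge (y := kerSet (g.comp π))
      ⟨⟨N, hN, g.comp π, rfl⟩, fun x y hxy => (hg.ge hxy : (x, y) ∈ diagonal C.Carrier)⟩
      (fun p hp => congrArg g ((hπ _ _).2 hp))
    ext ⟨a, b⟩
    obtain ⟨a, rfl⟩ := hsurj a
    obtain ⟨b, rfl⟩ := hsurj b
    exact ⟨fun h => congrArg g h, fun h => (hπ a b).2 (hle (a := (a, b)) h)⟩
  refine ⟨ofSub M f.range, ⟨hE, ⟨_, hE, Hom.id L _, rfl⟩, ?_⟩, π, hinj⟩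
  rintro _ ⟨N₁, hN₁, g₁, rfl⟩ _ ⟨N₂, hN₂, g₂, rfl⟩ hinter
  refine (hC.2.2 _ ⟨N₁, hN₁, g₁.comp (π.comp ψ), rfl⟩ _ ⟨N₂, hN₂, g₂.comp (π.comp ψ), rfl⟩ ?_).imp
    (hker hN₁ g₁) (hker hN₂ g₂)
  ext ⟨x, y⟩
  exact hinj.eq_iff.symm.trans (Set.ext_iff.1 hinter (π (ψ x), π (ψ y)))

/-- Lemma 4.2: if a quasivariety `Q` has the TIP, then so does `Q_RFSI`. -/
theorem stmt16 (L : FirstOrder.Language.{u, u}) [L.IsAlgebraic]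
    (Q : Set (Struc L)) (hQ : IsQuasivariety L Q) (h : HasTIP Q) :
    HasTIP (RFSI Q) := by
  intro A hA B hB C hC φB φC hφB
  obtain ⟨D, hD, ψB, ψC, hψC, hcomm⟩ := h A hA.1 B hB.1 C hC.1 φB φC hφB
  obtain ⟨E, hE, π, hπ⟩ := exists_hom_rfsi_injective_comp hQ hC hD ψC hψC
  exact ⟨E, hE, π.comp ψB, π.comp ψC, hπ, fun a => congrArg π (hcomm a)⟩

end Transfer
end

section
/- Let K be a class of L-structures that is closed under substructures. Then K has surjective epimorphisms if and only if no member of K has a proper K-epic substructure. -/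
open FirstOrder Language Set

universe u

namespace Transfer

variable (L : FirstOrder.Language.{u, u})

variable {L}

variable (L)

variable {L}

/-- Lemma 4.6: a class closed under substructures has surjective epimorphisms
iff no member has a proper epic substructure. -/
theorem stmt18 (L : FirstOrder.Language.{u, u}) [L.IsAlgebraic]
    (K : Set (Struc L)) (h : SubClosed K) :
    HasSE K ↔ ∀ B ∈ K, ∀ S : L.Substructure B.Carrier,
      S ≠ ⊤ → ¬ IsEpiIn K (A := ofSub B S) (B := B) S.subtype.toHom := by
  refine ⟨fun hSE B hB S hS hepi => hS ?_, fun hK A _ B hB φ hφ => ?_⟩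
  · refine eq_top_iff.2 fun b _ => ?_
    obtain ⟨a, rfl⟩ := hSE (ofSub B S) (h B hB S) B hB _ hepi b
    exact a.2
  · by_contra hsurj
    refine hK B hB φ.range (fun htop => hsurj (Hom.range_eq_top.1 htop)) ?_
    intro C hC ψ₁ ψ₂ hψ
    refine hφ C hC ψ₁ ψ₂ (Hom.ext fun a => ?_)
    exact DFunLike.congr_fun hψ ⟨φ a, Hom.mem_range_self φ a⟩

end Transfer
end
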